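/- Let m ≥ 1, b ≠ 0 a real number, and c_1,…,c_m real constants. For j = 1,…,m, let φ_j : ℝʲ → ℝ be (m-j+1) times continuously differentiable with φ_j(0) = 0. Define the gain functions τ_0 := 0 and, recursively for j = 1,…,m-1, τ_j(x_1,…,x_j, Δ_0,…,Δ_{j-1}) := -c_j (b x_j − τ_{j-1}(x_1,…,x_{j-1}, Δ_0,…,Δ_{j-2}) − Δ_{j-1}) − b φ_j(x_1,…,x_j) + Σ_{k=1}^{j-1} [ (∂τ_{j-1}/∂x_k)·(x_{k+1} + φ_k(x_1,…,x_k)) + (∂τ_{j-1}/∂Δ_{k-1})·Δ_k ]. For each parameter vector Δ = (Δ_0,…,Δ_{m-1}) ∈ ℝᵐ define Ψ_Δ : ℝᵐ → ℝᵐ by (Ψ_Δ(x))_j := b x_j − τ_{j-1}(x_1,…,x_{j-1}, Δ_0,…,Δ_{j-2}) − Δ_{j-1}. Then: (a) for every Δ ∈ ℝᵐ, Ψ_Δ is a bijection of ℝᵐ; (b) there exist continuously differentiable functions τ̄_j : ℝʲ × ℝʲ → ℝ for j = 0,…,m-1 (with τ̄_0 := 0) satisfying τ̄_j(0,0) = 0,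 such that the inverse map is given componentwise by x_j = (1/b) r_j + τ̄_{j-1}(r_1,…,r_{j-1}, Δ_0,…,Δ_{j-2}) + (1/b) Δ_{j-1} where r = Ψ_Δ(x); and (c) b·τ̄_{j-1}(Ψ_Δ(x)_1,…,Ψ_Δ(x)_{j-1}, Δ_0,…,Δ_{j-2}) = τ_{j-1}(x_1,…,x_{j-1}, Δ_0,…,Δ_{j-2}) for all x, Δ and all j = 1,…,m. -/

import Mathlib

open Set Finset

/-- Extension of a finite vector to a sequence, by zero. -/
noncomputable def extendFin (m : ℕ) (x : Fin m → ℝ) : ℕ → ℝ :=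
  fun j => if h : j < m then x ⟨j, h⟩ else 0

/-- The recursively defined predictor-based backstepping gain functions `τ_j`
(0-based data: `c j` is the paper's `c_{j+1}`, `φ j` is the paper's `φ_{j+1}`;
`τgain b c φ j` is the paper's `τ_j`, depending on `x_1,…,x_j` (coordinates
`0,…,j-1`) and `Δ_0,…,Δ_{j-1}`). -/
noncomputable def τgain (b : ℝ) (c : ℕ → ℝ) (φ : ℕ → (ℕ → ℝ) → ℝ) :
    ℕ → (ℕ → ℝ) → (ℕ → ℝ) → ℝ
  | 0 => fun _ _ => 0
  | (j + 1) => fun x Δ =>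
      -(c j) * (b * x j - τgain b c φ j x Δ - Δ j) - b * φ j x
        + ∑ l ∈ Finset.range j,
            (deriv (fun a => τgain b c φ j (Function.update x l a) Δ) (x l)
                * (x (l + 1) + φ l x)
              + deriv (fun a => τgain b c φ j x (Function.update Δ l a)) (Δ l)
                * Δ (l + 1))

/-- A sequence vanishing from index `m` on is the extension of its first `m` entries. -/
lemma extendFin_restrict {m : ℕ} {y : ℕ → ℝ} (hy : ∀ l, m ≤ l → y l = 0) :
    extendFin m (fun i : Fin m => y i) = y := by
  funext l
  by_cases h : l < m
  · simp [extendFin, h]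
  · simp [extendFin, h, hy l (not_lt.mp h)]

lemma extendFin_of_lt {m l : ℕ} (x : Fin m → ℝ) (h : l < m) :
    extendFin m x l = x ⟨l, h⟩ := by
  simp [extendFin, h]

lemma extendFin_of_le {m l : ℕ} (x : Fin m → ℝ) (h : m ≤ l) : extendFin m x l = 0 := by
  simp [extendFin, not_lt.mpr h]

lemma update_extendFin {m l : ℕ} (x : Fin m → ℝ) (h : l < m) (a : ℝ) :
    Function.update (extendFin m x) l a = extendFin m (Function.update x ⟨l, h⟩ a) := by
  funext i
  by_cases hi : i = l
  · subst hi
    simp [extendFin, h]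
  · by_cases him : i < m <;> simp [extendFin, him, hi]

lemma contDiff_extendFin_apply {n : WithTop ℕ∞} {E : Type*} [NormedAddCommGroup E]
    [NormedSpace ℝ E] {m : ℕ} {u : E → Fin m → ℝ} (hu : ContDiff ℝ n u) (l : ℕ) :
    ContDiff ℝ n (fun e => extendFin m (u e) l) := by
  by_cases h : l < m
  · simpa only [extendFin_of_lt _ h] using contDiff_pi.mp hu ⟨l, h⟩
  · simpa only [extendFin_of_le _ (not_lt.mp h)] using contDiff_const

section Gain

variable {m : ℕ} {b : ℝ} {c : ℕ → ℝ} {φ : ℕ → (ℕ → ℝ) → ℝ}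

/-- `τgain b c φ j` depends only on the first `j` entries of each argument. -/
lemma τgain_congr
    (hφdep : ∀ j < m, ∀ x x' : ℕ → ℝ, (∀ l ≤ j, x l = x' l) → φ j x = φ j x')
    {j : ℕ} (hj : j ≤ m) {x x' Δ Δ' : ℕ → ℝ} (hx : ∀ l < j, x l = x' l)
    (hΔ : ∀ l < j, Δ l = Δ' l) : τgain b c φ j x Δ = τgain b c φ j x' Δ' := by
  induction j generalizing x x' Δ Δ' with
  | zero => rfl
  | succ j ih =>
    have update_congr : ∀ {y y' : ℕ → ℝ}, (∀ i < j + 1, y i = y' i) → ∀ (l : ℕ) (a : ℝ),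
        ∀ i < j, Function.update y l a i = Function.update y' l a i := by
      intro y y' h l a i hi
      by_cases hil : i = l
      · simp [hil]
      · simp [hil, h i (by omega)]
    have hx' : ∀ l < j, x l = x' l := fun l hl => hx l (by omega)
    have hΔ' : ∀ l < j, Δ l = Δ' l := fun l hl => hΔ l (by omega)
    simp only [τgain]
    rw [ih (by omega) hx' hΔ', hx j (by omega), hΔ j (by omega),
      hφdep j (by omega) x x' fun l hl => hx l (by omega)]
    congr 1
    refine Finset.sum_congr rfl fun l hl => ?_
    have hl : l < j := Finset.mem_range.mp hl
    have hderiv_x : (fun a => τgain b c φ j (Function.update x l a) Δ) =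
        fun a => τgain b c φ j (Function.update x' l a) Δ' :=
      funext fun a => ih (by omega) (update_congr hx l a) hΔ'
    have hderiv_Δ : (fun a => τgain b c φ j x (Function.update Δ l a)) =
        fun a => τgain b c φ j x' (Function.update Δ' l a) :=
      funext fun a => ih (by omega) hx' (update_congr hΔ l a)
    rw [hderiv_x, hderiv_Δ, hx l (by omega), hΔ l (by omega), hx (l + 1) (by omega),
      hΔ (l + 1) (by omega), hφdep l (by omega) x x' fun i hi => hx i (by omega)]

lemma τgain_zero_zero (hφ0 : ∀ j < m, φ j 0 = 0) {j : ℕ} (hj : j ≤ m) :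
    τgain b c φ j 0 0 = 0 := by
  induction j with
  | zero => rfl
  | succ j ih =>
    have hsum : ∀ l ∈ Finset.range j, φ l 0 = 0 := fun l hl =>
      hφ0 l (by have := Finset.mem_range.mp hl; omega)
    simp only [τgain, ih (by omega), hφ0 j (by omega), Pi.zero_apply, zero_add, mul_zero,
      sub_zero, add_zero]
    exact Finset.sum_eq_zero fun l hl => by rw [hsum l hl, mul_zero]

/-- Each nonlinearity, read on `Fin m → ℝ`, keeps its order of differentiability. -/
lemma contDiff_nonlinearity
    (hφdep : ∀ j < m, ∀ x x' : ℕ → ℝ, (∀ l ≤ j, x l = x' l) → φ j x = φ j x')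
    (hφsmooth : ∀ j < m, ContDiff ℝ ((m - j : ℕ) : ℕ∞)
      (fun x : Fin (j + 1) → ℝ => φ j (extendFin (j + 1) x)))
    {j : ℕ} (hj : j < m) :
    ContDiff ℝ ((m - j : ℕ) : ℕ∞) (fun x : Fin m → ℝ => φ j (extendFin m x)) := by
  have hrestrict : ContDiff ℝ ((m - j : ℕ) : ℕ∞)
      (fun (x : Fin m → ℝ) (i : Fin (j + 1)) => extendFin m x i) :=
    contDiff_pi.mpr fun i => contDiff_extendFin_apply contDiff_id i
  have heq : (fun x : Fin m → ℝ => φ j (extendFin m x)) = fun x =>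
      φ j (extendFin (j + 1) (fun i : Fin (j + 1) => extendFin m x i)) := by
    funext x
    refine hφdep j hj _ _ fun l hl => ?_
    rw [extendFin_of_lt _ (Nat.lt_succ_of_le hl)]
  rw [heq]
  exact (hφsmooth j hj).comp hrestrict

lemma contDiff_τgain
    (hφdep : ∀ j < m, ∀ x x' : ℕ → ℝ, (∀ l ≤ j, x l = x' l) → φ j x = φ j x')
    (hφsmooth : ∀ j < m, ContDiff ℝ ((m - j : ℕ) : ℕ∞)
      (fun x : Fin (j + 1) → ℝ => φ j (extendFin (j + 1) x)))
    {j : ℕ} (hj : j ≤ m) :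
    ContDiff ℝ ((m + 1 - j : ℕ) : ℕ∞) (fun p : (Fin m → ℝ) × (Fin m → ℝ) =>
      τgain b c φ j (extendFin m p.1) (extendFin m p.2)) := by
  induction j with
  | zero => exact contDiff_const
  | succ j ih =>
    set F : (Fin m → ℝ) × (Fin m → ℝ) → ℝ := fun p =>
      τgain b c φ j (extendFin m p.1) (extendFin m p.2) with hF
    have hFsmooth : ContDiff ℝ (((m - j : ℕ) : ℕ∞) + 1 : WithTop ℕ∞) F := by
      have h := ih (by omega)
      rw [show m + 1 - j = (m - j) + 1 by omega] at h
      exact_mod_cast h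
    have hFdiff : Differentiable ℝ F := hFsmooth.differentiable (by simp)
    have hF' : ∀ v, ContDiff ℝ ((m - j : ℕ) : ℕ∞) (fun p => fderiv ℝ F p v) := fun v =>
      (hFsmooth.fderiv_right le_rfl).clm_apply contDiff_const
    have hx : ∀ l, ContDiff ℝ ((m - j : ℕ) : ℕ∞)
        (fun p : (Fin m → ℝ) × (Fin m → ℝ) => extendFin m p.1 l) :=
      contDiff_extendFin_apply contDiff_fst
    have hΔ : ∀ l, ContDiff ℝ ((m - j : ℕ) : ℕ∞)
        (fun p : (Fin m → ℝ) × (Fin m → ℝ) => extendFin m p.2 l) :=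
      contDiff_extendFin_apply contDiff_snd
    have hφ : ∀ l ≤ j, ContDiff ℝ ((m - j : ℕ) : ℕ∞)
        (fun p : (Fin m → ℝ) × (Fin m → ℝ) => φ l (extendFin m p.1)) := fun l hl =>
      ((contDiff_nonlinearity hφdep hφsmooth (by omega : l < m)).of_le
        (by exact_mod_cast (by omega : m - j ≤ m - l))).comp contDiff_fst
    have hderiv_x : ∀ l (hl : l < m) (p : (Fin m → ℝ) × (Fin m → ℝ)),
        deriv (fun a => τgain b c φ j (Function.update (extendFin m p.1) l a)
          (extendFin m p.2)) (extendFin m p.1 l) =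
        fderiv ℝ F p (Pi.single ⟨l, hl⟩ 1, 0) := by
      intro l hl p
      simp only [update_extendFin _ hl, extendFin_of_lt _ hl]
      have hcurve : HasDerivAt (fun a : ℝ => (Function.update p.1 ⟨l, hl⟩ a, p.2))
          (Pi.single ⟨l, hl⟩ 1, 0) (p.1 ⟨l, hl⟩) :=
        (hasDerivAt_update p.1 ⟨l, hl⟩ _).prodMk (hasDerivAt_const _ _)
      have hp := (hFdiff p).hasFDerivAt
      exact (hp.comp_hasDerivAt_of_eq _ hcurve (by simp)).deriv
    have hderiv_Δ : ∀ l (hl : l < m) (p : (Fin m → ℝ) × (Fin m → ℝ)),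
        deriv (fun a => τgain b c φ j (extendFin m p.1)
          (Function.update (extendFin m p.2) l a)) (extendFin m p.2 l) =
        fderiv ℝ F p (0, Pi.single ⟨l, hl⟩ 1) := by
      intro l hl p
      simp only [update_extendFin _ hl, extendFin_of_lt _ hl]
      have hcurve : HasDerivAt (fun a : ℝ => (p.1, Function.update p.2 ⟨l, hl⟩ a))
          (0, Pi.single ⟨l, hl⟩ 1) (p.2 ⟨l, hl⟩) :=
        (hasDerivAt_const _ _).prodMk (hasDerivAt_update p.2 ⟨l, hl⟩ _)
      have hp := (hFdiff p).hasFDerivAt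
      exact (hp.comp_hasDerivAt_of_eq _ hcurve (by simp)).deriv
    rw [show m + 1 - (j + 1) = m - j by omega]
    simp only [τgain]
    refine ((contDiff_const.mul (((contDiff_const.mul (hx j)).sub
      (hFsmooth.of_le le_self_add)).sub (hΔ j))).sub
      (contDiff_const.mul (hφ j le_rfl))).add (ContDiff.sum fun l hl => ?_)
    have hl : l < j := Finset.mem_range.mp hl
    simp only [hderiv_x l (by omega), hderiv_Δ l (by omega)]
    exact ((hF' _).mul ((hx (l + 1)).add (hφ l hl.le))).add ((hF' _).mul (hΔ (l + 1)))

end Gain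

/-- Forward substitution: the first `n` coordinates of the solution `x` of
`r j = b * x j - τgain b c φ j x Δ - Δ j`, followed by zeros. -/
noncomputable def forwardSubst (b : ℝ) (c : ℕ → ℝ) (φ : ℕ → (ℕ → ℝ) → ℝ) (r Δ : ℕ → ℝ) :
    ℕ → ℕ → ℝ
  | 0 => 0
  | n + 1 => Function.update (forwardSubst b c φ r Δ n) n
      ((r n + τgain b c φ n (forwardSubst b c φ r Δ n) Δ + Δ n) / b)

section ForwardSubst

variable {m : ℕ} {b : ℝ} {c : ℕ → ℝ} {φ : ℕ → (ℕ → ℝ) → ℝ}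

lemma forwardSubst_of_le {r Δ : ℕ → ℝ} {n l : ℕ} (h : n ≤ l) :
    forwardSubst b c φ r Δ n l = 0 := by
  induction n with
  | zero => rfl
  | succ n ih =>
    rw [forwardSubst, Function.update_of_ne (by omega), ih (by omega)]

lemma forwardSubst_of_lt {r Δ : ℕ → ℝ} {k n l : ℕ} (hl : l < k) (hk : k ≤ n) :
    forwardSubst b c φ r Δ n l = forwardSubst b c φ r Δ k l := by
  induction n, hk using Nat.le_induction with
  | base => rfl
  | succ n hn ih => rw [forwardSubst, Function.update_of_ne (by omega), ih]

lemma forwardSubst_congr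
    (hφdep : ∀ j < m, ∀ x x' : ℕ → ℝ, (∀ l ≤ j, x l = x' l) → φ j x = φ j x')
    {n : ℕ} (hn : n ≤ m) {r r' Δ Δ' : ℕ → ℝ} (hr : ∀ l < n, r l = r' l)
    (hΔ : ∀ l < n, Δ l = Δ' l) :
    forwardSubst b c φ r Δ n = forwardSubst b c φ r' Δ' n := by
  induction n with
  | zero => rfl
  | succ n ih =>
    rw [forwardSubst, forwardSubst,
      ih (by omega) (fun l hl => hr l (by omega)) fun l hl => hΔ l (by omega),
      τgain_congr hφdep (by omega) (fun _ _ => rfl) fun l hl => hΔ l (by omega),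
      hr n (by omega), hΔ n (by omega)]

lemma forwardSubst_zero_zero (hφ0 : ∀ j < m, φ j 0 = 0) {n : ℕ} (hn : n ≤ m) :
    forwardSubst b c φ 0 0 n = 0 := by
  induction n with
  | zero => rfl
  | succ n ih =>
    rw [forwardSubst, ih (by omega), τgain_zero_zero hφ0 (by omega)]
    simp

/-- Forward substitution recovers `x` from its transform. -/
lemma forwardSubst_transform (hb : b ≠ 0)
    (hφdep : ∀ j < m, ∀ x x' : ℕ → ℝ, (∀ l ≤ j, x l = x' l) → φ j x = φ j x')
    {n : ℕ} (hn : n ≤ m) {x r Δ : ℕ → ℝ}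
    (hr : ∀ l < n, r l = b * x l - τgain b c φ l x Δ - Δ l) :
    ∀ l < n, forwardSubst b c φ r Δ n l = x l := by
  induction n with
  | zero => intro l hl; omega
  | succ n ih =>
    have ih := ih (by omega) fun l hl => hr l (by omega)
    intro l hl
    rw [forwardSubst]
    by_cases h : l = n
    · subst h
      rw [Function.update_self, τgain_congr hφdep (by omega) ih fun _ _ => rfl, hr l hl]
      field_simp
      ring
    · rw [Function.update_of_ne h, ih l (by omega)]

/-- The transform of the forward substitution of `r` is `r`. -/
lemma transform_forwardSubst (hb : b ≠ 0)
    (hφdep : ∀ j < m, ∀ x x' : ℕ → ℝ, (∀ l ≤ j, x l = x' l) → φ j x = φ j x')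
    (r Δ : ℕ → ℝ) {l : ℕ} (hl : l < m) :
    b * forwardSubst b c φ r Δ m l - τgain b c φ l (forwardSubst b c φ r Δ m) Δ - Δ l = r l := by
  rw [forwardSubst_of_lt (Nat.lt_succ_self l) hl, forwardSubst, Function.update_self,
    τgain_congr hφdep hl.le (x := forwardSubst b c φ r Δ m)
      (fun i hi => forwardSubst_of_lt hi hl.le) fun _ _ => rfl]
  field_simp
  ring

lemma contDiff_τgain_forwardSubst
    (hφdep : ∀ j < m, ∀ x x' : ℕ → ℝ, (∀ l ≤ j, x l = x' l) → φ j x = φ j x')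
    (hφsmooth : ∀ j < m, ContDiff ℝ ((m - j : ℕ) : ℕ∞)
      (fun x : Fin (j + 1) → ℝ => φ j (extendFin (j + 1) x)))
    {E : Type*} [NormedAddCommGroup E] [NormedSpace ℝ E] {r Δ : E → ℕ → ℝ} {n : ℕ}
    (hn : n ≤ m) (hΔ : ∀ l, ContDiff ℝ 1 (fun e => Δ e l)) (hΔ0 : ∀ e l, m ≤ l → Δ e l = 0)
    (hX : ∀ l, ContDiff ℝ 1 (fun e => forwardSubst b c φ (r e) (Δ e) n l)) :
    ContDiff ℝ 1 (fun e => τgain b c φ n (forwardSubst b c φ (r e) (Δ e) n) (Δ e)) := by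
  have hX' : ContDiff ℝ 1 (fun e (i : Fin m) => forwardSubst b c φ (r e) (Δ e) n i) :=
    contDiff_pi.mpr fun i => hX i
  have hΔ' : ContDiff ℝ 1 (fun e (i : Fin m) => Δ e i) := contDiff_pi.mpr fun i => hΔ i
  have hτ := ((contDiff_τgain (b := b) (c := c) hφdep hφsmooth hn).of_le
    (by exact_mod_cast (by omega : 1 ≤ m + 1 - n))).comp (hX'.prodMk hΔ')
  convert hτ using 2 with e
  simp only [Function.comp_apply]
  rw [extendFin_restrict (hΔ0 e), extendFin_restrict fun l hl => forwardSubst_of_le (hn.trans hl)]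

lemma contDiff_forwardSubst
    (hφdep : ∀ j < m, ∀ x x' : ℕ → ℝ, (∀ l ≤ j, x l = x' l) → φ j x = φ j x')
    (hφsmooth : ∀ j < m, ContDiff ℝ ((m - j : ℕ) : ℕ∞)
      (fun x : Fin (j + 1) → ℝ => φ j (extendFin (j + 1) x)))
    {E : Type*} [NormedAddCommGroup E] [NormedSpace ℝ E] {r Δ : E → ℕ → ℝ} {n : ℕ}
    (hn : n ≤ m) (hr : ∀ l, ContDiff ℝ 1 (fun e => r e l))
    (hΔ : ∀ l, ContDiff ℝ 1 (fun e => Δ e l)) (hΔ0 : ∀ e l, m ≤ l → Δ e l = 0) (l : ℕ) :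
    ContDiff ℝ 1 (fun e => forwardSubst b c φ (r e) (Δ e) n l) := by
  induction n generalizing l with
  | zero => exact contDiff_const
  | succ n ih =>
    simp only [forwardSubst]
    by_cases h : l = n
    · subst h
      simp only [Function.update_self]
      exact (((hr l).add (contDiff_τgain_forwardSubst hφdep hφsmooth
        (by omega) hΔ hΔ0 (ih (by omega)))).add (hΔ l)).div_const b
    · simpa only [Function.update_of_ne h] using ih (by omega) l

end ForwardSubst

/-- Proposition 1, `X`-part: the predictor-based nonundershooting
backstepping transformation `(Ψ_Δ(x))_j = b x_j - τ_{j-1}(x,Δ) - Δ_{j-1}` is a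
bijection of `ℝᵐ` for every parameter vector `Δ`, and its inverse has the
triangular form `x_j = (1/b) r_j + τ̄_{j-1}(r,Δ) + (1/b) Δ_{j-1}` with continuously
differentiable `τ̄_j` vanishing at the origin, and
`b τ̄_{j-1}(Ψ_Δ(x), Δ) = τ_{j-1}(x, Δ)`. -/
theorem stmt_8 (m : ℕ) (hm : 1 ≤ m) (b : ℝ) (hb : b ≠ 0) (c : ℕ → ℝ)
    (φ : ℕ → (ℕ → ℝ) → ℝ)
    (hφdep : ∀ j < m, ∀ x x' : ℕ → ℝ, (∀ l ≤ j, x l = x' l) → φ j x = φ j x')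
    (hφsmooth : ∀ j < m, ContDiff ℝ ((m - j : ℕ) : ℕ∞)
      (fun x : Fin (j + 1) → ℝ => φ j (extendFin (j + 1) x)))
    (hφ0 : ∀ j < m, φ j 0 = 0) :
    (∀ Δ : Fin m → ℝ, Function.Bijective
        (fun x : Fin m → ℝ => fun j : Fin m =>
          b * x j - τgain b c φ j (extendFin m x) (extendFin m Δ) - Δ j)) ∧
    ∃ τbar : ℕ → (ℕ → ℝ) → (ℕ → ℝ) → ℝ,
      (∀ r Δ, τbar 0 r Δ = 0) ∧
      (∀ j < m,
        (∀ r r' Δ Δ' : ℕ → ℝ, (∀ l < j, r l = r' l) → (∀ l < j, Δ l = Δ' l) →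
            τbar j r Δ = τbar j r' Δ') ∧
        ContDiff ℝ 1 (fun p : (Fin j → ℝ) × (Fin j → ℝ) =>
          τbar j (extendFin j p.1) (extendFin j p.2)) ∧
        τbar j 0 0 = 0) ∧
      (∀ Δ x : Fin m → ℝ, ∀ j : Fin m,
        x j = (1 / b) * (b * x j - τgain b c φ j (extendFin m x) (extendFin m Δ) - Δ j)
          + τbar j (extendFin m (fun l : Fin m =>
              b * x l - τgain b c φ l (extendFin m x) (extendFin m Δ) - Δ l)) (extendFin m Δ)
          + (1 / b) * Δ j) ∧
      (∀ Δ x : Fin m → ℝ, ∀ j < m,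
        b * τbar j (extendFin m (fun l : Fin m =>
            b * x l - τgain b c φ l (extendFin m x) (extendFin m Δ) - Δ l)) (extendFin m Δ)
          = τgain b c φ j (extendFin m x) (extendFin m Δ)) := by
  have hrecover : ∀ Δ x : Fin m → ℝ, ∀ j ≤ m, ∀ l < j,
      forwardSubst b c φ (extendFin m (fun l : Fin m =>
        b * x l - τgain b c φ l (extendFin m x) (extendFin m Δ) - Δ l)) (extendFin m Δ) j l =
      extendFin m x l := by
    intro Δ x j hj
    refine forwardSubst_transform hb hφdep hj fun l hl => ?_
    have hlm : l < m := by omega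
    simp only [extendFin_of_lt _ hlm]
  have hgain : ∀ Δ x : Fin m → ℝ, ∀ j < m,
      b * (τgain b c φ j (forwardSubst b c φ (extendFin m (fun l : Fin m =>
        b * x l - τgain b c φ l (extendFin m x) (extendFin m Δ) - Δ l)) (extendFin m Δ) j)
        (extendFin m Δ) / b) = τgain b c φ j (extendFin m x) (extendFin m Δ) := by
    intro Δ x j hj
    rw [mul_div_cancel₀ _ hb]
    exact τgain_congr hφdep hj.le (hrecover Δ x j hj.le) fun _ _ => rfl
  refine ⟨fun Δ => ⟨fun x y hxy => ?_, fun r => ?_⟩,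
    fun j r Δ => τgain b c φ j (forwardSubst b c φ r Δ j) Δ / b, ?_, fun j hj => ⟨?_, ?_, ?_⟩,
    fun Δ x j => ?_, hgain⟩
  · funext i
    have hx := hrecover Δ x m le_rfl i i.isLt
    have hy := hrecover Δ y m le_rfl i i.isLt
    simp only at hxy
    rw [hxy, hy, extendFin_of_lt _ i.isLt, extendFin_of_lt _ i.isLt] at hx
    exact hx.symm
  · refine ⟨fun i => forwardSubst b c φ (extendFin m r) (extendFin m Δ) m i, funext fun i => ?_⟩
    have h := transform_forwardSubst (c := c) hb hφdep (extendFin m r) (extendFin m Δ) i.isLt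
    simp only [extendFin_of_lt _ i.isLt] at h
    simp only
    rw [extendFin_restrict fun l hl => forwardSubst_of_le hl]
    exact h
  · intro r Δ
    simp [τgain]
  · intro r r' Δ Δ' hr hΔ
    simp only
    rw [forwardSubst_congr hφdep hj.le hr hΔ, τgain_congr hφdep hj.le (fun _ _ => rfl) hΔ]
  · have hr : ∀ l, ContDiff ℝ 1 (fun p : (Fin j → ℝ) × (Fin j → ℝ) => extendFin j p.1 l) :=
      contDiff_extendFin_apply contDiff_fst
    have hΔ : ∀ l, ContDiff ℝ 1 (fun p : (Fin j → ℝ) × (Fin j → ℝ) => extendFin j p.2 l) :=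
      contDiff_extendFin_apply contDiff_snd
    have hΔ0 : ∀ (p : (Fin j → ℝ) × (Fin j → ℝ)) (l : ℕ), m ≤ l → extendFin j p.2 l = 0 :=
      fun p l hl => extendFin_of_le _ (hj.le.trans hl)
    exact (contDiff_τgain_forwardSubst hφdep hφsmooth hj.le hΔ hΔ0
      (contDiff_forwardSubst hφdep hφsmooth hj.le hr hΔ hΔ0)).div_const b
  · simp only
    rw [forwardSubst_zero_zero hφ0 hj.le, τgain_zero_zero hφ0 hj.le, zero_div]
  · have h := hgain Δ x j j.isLt
    rw [mul_comm, ← eq_div_iff hb] at h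
    simp only
    rw [h]
    field_simp
    ring
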